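/- Let m_j, m_k, m_l ∈ ℝ satisfy m_j + σ₁ m_k + σ₂ m_l ≠ 0 for all sign choices σ₁, σ₂ ∈ {±1}, and let (p, p̃)ᵀ = A_{jkl}^{−1}(1, 0)ᵀ. Then there exist real constants C^{(1)}_{abμν} (0 ≤ a, b ≤ 2, |μ|, |ν| ≤ 1), C^{(2)}_{μν}, C^{(3)}_{μν} (|μ|, |ν| ≤ 1), and C^{(4)}, depending only on m_j, m_k, m_l, such that for all four-times continuously differentiable v, ṽ: ℝ × ℝ² → ℂ, setting h = (□ + m_k²)v and h̃ = (□ + m_l²)ṽ, one has v ṽ = (□ + m_j²)( p · v ṽ + p̃ · Q₀(v, ṽ) ) + Σ C^{(1)}_{abμν} Q_{ab}(∂^μ v, ∂^ν ṽ) + Σ C^{(2)}_{μν} (∂^μ v)(∂^ν h̃) + Σ C^{(3)}_{μν} (∂^μ h)(∂^ν ṽ) + C^{(4)} h h̃. -/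

import Mathlib

open MeasureTheory Matrix

noncomputable section

/-- Partial derivative `∂_a` on spacetime `ℝ^{1+2}` (coordinates `p 0 = t`, `p 1 = x₁`, `p 2 = x₂`). -/
def pd {E : Type*} [NormedAddCommGroup E] [NormedSpace ℝ E]
    (a : Fin 3) (u : (Fin 3 → ℝ) → E) : (Fin 3 → ℝ) → E :=
  fun p => fderiv ℝ u p (Pi.single a 1)

/-- d'Alembertian `□ = ∂_t² − ∂_1² − ∂_2²`. -/
def Box {E : Type*} [NormedAddCommGroup E] [NormedSpace ℝ E]
    (u : (Fin 3 → ℝ) → E) : (Fin 3 → ℝ) → E :=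
  fun p => pd 0 (pd 0 u) p - pd 1 (pd 1 u) p - pd 2 (pd 2 u) p

/-- Coordinate function with `x₀ = −t`, `x₁`, `x₂`. -/
def Xc (a : Fin 3) (p : Fin 3 → ℝ) : ℝ := if a = 0 then -(p 0) else p a

/-- The vector fields `Ω_{ab} = x_a ∂_b − x_b ∂_a`. -/
def Omg {E : Type*} [NormedAddCommGroup E] [NormedSpace ℝ E]
    (a b : Fin 3) (u : (Fin 3 → ℝ) → E) : (Fin 3 → ℝ) → E :=
  fun p => Xc a p • pd b u p - Xc b p • pd a u p

/-- Minkowski metric coefficients `(η_{ab}) = diag(−1,1,1)`. -/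
def eta (a b : Fin 3) : ℝ := if a = b then (if a = 0 then -1 else 1) else 0

/-- The family of vector fields `Z = (∂_t, ∂_1, ∂_2, Ω_{01}, Ω_{02}, Ω_{12})`. -/
def Zop {E : Type*} [NormedAddCommGroup E] [NormedSpace ℝ E] :
    Fin 6 → ((Fin 3 → ℝ) → E) → ((Fin 3 → ℝ) → E) :=
  ![pd 0, pd 1, pd 2, Omg 0 1, Omg 0 2, Omg 1 2]

/-- The null form `Q₀(u,v) = (∂_t u)(∂_t v) − (∂_1 u)(∂_1 v) − (∂_2 u)(∂_2 v)`. -/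
def Q0 (u v : (Fin 3 → ℝ) → ℂ) : (Fin 3 → ℝ) → ℂ :=
  fun p => pd 0 u p * pd 0 v p - pd 1 u p * pd 1 v p - pd 2 u p * pd 2 v p

/-- The strong null forms `Q_{ab}(u,v) = (∂_a u)(∂_b v) − (∂_b u)(∂_a v)`. -/
def Qab (a b : Fin 3) (u v : (Fin 3 → ℝ) → ℂ) : (Fin 3 → ℝ) → ℂ :=
  fun p => pd a u p * pd b v p - pd b u p * pd a v p

/-- `∂^μ` for a spacetime multi-index of order `≤ 1`: `none` is the identity operator
(order `0`), and `some a` is `∂_a` (order `1`). -/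
def pdOpt {E : Type*} [NormedAddCommGroup E] [NormedSpace ℝ E] :
    Option (Fin 3) → ((Fin 3 → ℝ) → E) → ((Fin 3 → ℝ) → E)
  | none => id
  | some a => pd a

section Calculus

variable {E : Type*} [NormedAddCommGroup E] [NormedSpace ℝ E]

lemma contDiff_pd {n m : WithTop ℕ∞} {u : (Fin 3 → ℝ) → E} (hu : ContDiff ℝ n u)
    (hmn : m + 1 ≤ n) (a : Fin 3) : ContDiff ℝ m (pd a u) :=
  (hu.fderiv_right hmn).clm_apply contDiff_const

lemma pd_add {u w : (Fin 3 → ℝ) → E} (hu : Differentiable ℝ u) (hw : Differentiable ℝ w)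
    (a : Fin 3) : pd a (fun q => u q + w q) = fun q => pd a u q + pd a w q := by
  funext p
  simp [pd, fderiv_fun_add (hu p) (hw p)]

lemma pd_sub {u w : (Fin 3 → ℝ) → E} (hu : Differentiable ℝ u) (hw : Differentiable ℝ w)
    (a : Fin 3) : pd a (fun q => u q - w q) = fun q => pd a u q - pd a w q := by
  funext p
  simp [pd, fderiv_fun_sub (hu p) (hw p)]

lemma pd_const_smul {u : (Fin 3 → ℝ) → E} (hu : Differentiable ℝ u) (c : ℝ)
    (a : Fin 3) : pd a (fun q => c • u q) = fun q => c • pd a u q := by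
  funext p
  simp [pd, fderiv_fun_const_smul (hu p) c]

lemma pd_mul {u w : (Fin 3 → ℝ) → ℂ} (hu : Differentiable ℝ u) (hw : Differentiable ℝ w)
    (a : Fin 3) : pd a (fun q => u q * w q) = fun q => pd a u q * w q + u q * pd a w q := by
  funext p
  simp only [pd, fderiv_fun_mul (hu p) (hw p), _root_.add_apply,
    _root_.smul_apply, smul_eq_mul]
  ring

lemma pd_comm {u : (Fin 3 → ℝ) → E} (hu : ContDiff ℝ 2 u) (a b : Fin 3) :
    pd a (pd b u) = pd b (pd a u) := by
  funext p
  have hd : DifferentiableAt ℝ (fderiv ℝ u) p :=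
    (hu.fderiv_right (m := 1) (by norm_num)).differentiable (by norm_num) p
  have key (c d : Fin 3) : pd c (pd d u) p =
      fderiv ℝ (fderiv ℝ u) p (Pi.single c 1) (Pi.single d 1) := by
    unfold pd
    rw [fderiv_clm_apply hd (differentiableAt_const _)]
    simp
  rw [key, key]
  exact (hu.contDiffAt.isSymmSndFDerivAt (by simp)) _ _

lemma ContDiff.differentiable_pd {u : (Fin 3 → ℝ) → E} (hu : ContDiff ℝ 2 u) (a : Fin 3) :
    Differentiable ℝ (pd a u) :=
  (contDiff_pd (m := 1) hu (by norm_num) a).differentiable (by norm_num)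

lemma contDiff_Box {n m : WithTop ℕ∞} {u : (Fin 3 → ℝ) → E} (hu : ContDiff ℝ n u)
    (hmn : m + 1 + 1 ≤ n) : ContDiff ℝ m (Box u) := by
  have h (a : Fin 3) : ContDiff ℝ m (pd a (pd a u)) :=
    contDiff_pd (contDiff_pd hu hmn a) le_rfl a
  exact ((h 0).sub (h 1)).sub (h 2)

lemma Box_add {u w : (Fin 3 → ℝ) → E} (hu : ContDiff ℝ 2 u) (hw : ContDiff ℝ 2 w)
    (p : Fin 3 → ℝ) : Box (fun q => u q + w q) p = Box u p + Box w p := by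
  have hu1 := hu.differentiable (by norm_num)
  have hw1 := hw.differentiable (by norm_num)
  simp only [Box, pd_add hu1 hw1, pd_add (hu.differentiable_pd _) (hw.differentiable_pd _)]
  abel

lemma Box_sub {u w : (Fin 3 → ℝ) → E} (hu : ContDiff ℝ 2 u) (hw : ContDiff ℝ 2 w)
    (p : Fin 3 → ℝ) : Box (fun q => u q - w q) p = Box u p - Box w p := by
  have hu1 := hu.differentiable (by norm_num)
  have hw1 := hw.differentiable (by norm_num)
  simp only [Box, pd_sub hu1 hw1, pd_sub (hu.differentiable_pd _) (hw.differentiable_pd _)]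
  abel

lemma Box_const_smul {u : (Fin 3 → ℝ) → E} (hu : ContDiff ℝ 2 u) (c : ℝ)
    (p : Fin 3 → ℝ) : Box (fun q => c • u q) p = c • Box u p := by
  have hu1 := hu.differentiable (by norm_num)
  simp only [Box, pd_const_smul hu1, pd_const_smul (hu.differentiable_pd _), smul_sub]

lemma Box_mul {u w : (Fin 3 → ℝ) → ℂ} (hu : ContDiff ℝ 2 u) (hw : ContDiff ℝ 2 w)
    (p : Fin 3 → ℝ) :
    Box (fun q => u q * w q) p = Box u p * w p + u p * Box w p + 2 * Q0 u w p := by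
  have hu1 := hu.differentiable (by norm_num)
  have hw1 := hw.differentiable (by norm_num)
  have hu2 := hu.differentiable_pd
  have hw2 := hw.differentiable_pd
  have key (a : Fin 3) : pd a (pd a (fun q => u q * w q)) p =
      pd a (pd a u) p * w p + u p * pd a (pd a w) p + 2 * (pd a u p * pd a w p) := by
    rw [pd_mul hu1 hw1, pd_add ((hu2 a).fun_mul hw1) (hu1.fun_mul (hw2 a)), pd_mul (hu2 a) hw1,
      pd_mul hu1 (hw2 a)]
    ring
  simp only [Box, Q0, key]
  ring

lemma Box_pd {u : (Fin 3 → ℝ) → E} (hu : ContDiff ℝ 3 u) (a : Fin 3) :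
    Box (pd a u) = pd a (Box u) := by
  have hu2 : ContDiff ℝ 2 u := hu.of_le (by norm_num)
  have h (b : Fin 3) : ContDiff ℝ 2 (pd b u) := contDiff_pd hu (by norm_num) b
  have key (b : Fin 3) : pd b (pd b (pd a u)) = pd a (pd b (pd b u)) := by
    rw [pd_comm hu2 b a, pd_comm (h b) b a]
  have h2 (b : Fin 3) := (h b).differentiable_pd b
  change (fun p => pd 0 (pd 0 (pd a u)) p - pd 1 (pd 1 (pd a u)) p - pd 2 (pd 2 (pd a u)) p) =
    pd a (fun p => pd 0 (pd 0 u) p - pd 1 (pd 1 u) p - pd 2 (pd 2 u) p)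
  rw [pd_sub ((h2 0).fun_sub (h2 1)) (h2 2), pd_sub (h2 0) (h2 1)]
  simp only [key]

lemma pd_kleinGordon {u : (Fin 3 → ℝ) → E} (hu : ContDiff ℝ 3 u) (c : ℝ) (a : Fin 3) :
    pd a (fun q => Box u q + c • u q) = fun q => pd a (Box u) q + c • pd a u q := by
  have hu1 := hu.differentiable (by norm_num)
  have hB : Differentiable ℝ (Box u) :=
    (contDiff_Box (m := 1) hu (by norm_num)).differentiable (by norm_num)
  rw [pd_add hB (hu1.fun_const_smul c), pd_const_smul hu1]

end Calculus

lemma contDiff_Q0 {n m : WithTop ℕ∞} {u w : (Fin 3 → ℝ) → ℂ} (hu : ContDiff ℝ n u)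
    (hw : ContDiff ℝ n w) (hmn : m + 1 ≤ n) : ContDiff ℝ m (Q0 u w) := by
  have h (a : Fin 3) : ContDiff ℝ m (fun p => pd a u p * pd a w p) :=
    (contDiff_pd hu hmn a).mul (contDiff_pd hw hmn a)
  exact ((h 0).sub (h 1)).sub (h 2)

/-- The sum of `η_{aa} η_{bb} Q_{ab}(∂_a u, ∂_b w)` is the defect in replacing the contraction of
the two Hessians by the product of their traces. -/
lemma Box_Q0 {u w : (Fin 3 → ℝ) → ℂ} (hu : ContDiff ℝ 3 u) (hw : ContDiff ℝ 3 w)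
    (p : Fin 3 → ℝ) :
    Box (Q0 u w) p = Q0 (Box u) w p + Q0 u (Box w) p + 2 * (Box u p * Box w p)
      - 2 * ∑ a : Fin 3, ∑ b : Fin 3,
          (eta a a * eta b b) • Qab a b (pd a u) (pd b w) p := by
  have hu2 : ContDiff ℝ 2 u := hu.of_le (by norm_num)
  have hw2 : ContDiff ℝ 2 w := hw.of_le (by norm_num)
  have du (a : Fin 3) : ContDiff ℝ 2 (pd a u) := contDiff_pd hu (by norm_num) a
  have dw (a : Fin 3) : ContDiff ℝ 2 (pd a w) := contDiff_pd hw (by norm_num) a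
  have h (a : Fin 3) := (du a).mul (dw a)
  change Box (fun p => pd 0 u p * pd 0 w p - pd 1 u p * pd 1 w p - pd 2 u p * pd 2 w p) p = _
  rw [Box_sub ((h 0).sub (h 1)) (h 2), Box_sub (h 0) (h 1), Box_mul (du 0) (dw 0),
    Box_mul (du 1) (dw 1), Box_mul (du 2) (dw 2)]
  simp only [Box_pd hu, Box_pd hw, Q0, Qab, Fin.sum_univ_three, eta, Complex.real_smul]
  rw [pd_comm hu2 1 0, pd_comm hu2 2 0, pd_comm hu2 2 1, pd_comm hw2 1 0, pd_comm hw2 2 0,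
    pd_comm hw2 2 1]
  simp [Box]
  ring

lemma resonance_det_ne_zero {mj mk ml : ℝ}
    (hres : ∀ σ1 σ2 : ℝ, (σ1 = 1 ∨ σ1 = -1) → (σ2 = 1 ∨ σ2 = -1) →
      mj + σ1 * mk + σ2 * ml ≠ 0) :
    (!![mj ^ 2 - mk ^ 2 - ml ^ 2, 2 * mk ^ 2 * ml ^ 2;
        2, mj ^ 2 - mk ^ 2 - ml ^ 2] : Matrix (Fin 2) (Fin 2) ℝ).det ≠ 0 := by
  have h1 := hres 1 1 (by simp) (by simp)
  have h2 := hres 1 (-1) (by simp) (by simp)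
  have h3 := hres (-1) 1 (by simp) (by simp)
  have h4 := hres (-1) (-1) (by simp) (by simp)
  rw [Matrix.det_fin_two_of]
  convert mul_ne_zero (mul_ne_zero h1 h4) (mul_ne_zero h2 h3) using 1
  ring

/-- under the non-resonance condition, with `(p, p̃)ᵀ = A_{jkl}⁻¹ (1,0)ᵀ`,
`v ṽ = (□ + m_j²)(p·vṽ + p̃·Q₀(v,ṽ)) + Σ C⁽¹⁾ Q_{ab}(∂^μv, ∂^νṽ)
 + Σ C⁽²⁾ (∂^μv)(∂^νh̃) + Σ C⁽³⁾ (∂^μh)(∂^νṽ) + C⁽⁴⁾ h h̃`,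
where `h = (□+m_k²)v`, `h̃ = (□+m_l²)ṽ`. -/
theorem normal_form_transformation (mj mk ml : ℝ)
    (hres : ∀ σ1 σ2 : ℝ, (σ1 = 1 ∨ σ1 = -1) → (σ2 = 1 ∨ σ2 = -1) →
      mj + σ1 * mk + σ2 * ml ≠ 0) :
    ∃ (C1 : Fin 3 → Fin 3 → Option (Fin 3) → Option (Fin 3) → ℝ)
      (C2 C3 : Option (Fin 3) → Option (Fin 3) → ℝ) (C4 : ℝ),
      ∀ v vt : (Fin 3 → ℝ) → ℂ, ContDiff ℝ 4 v → ContDiff ℝ 4 vt →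
        ∀ p, v p * vt p
          = (Box (fun q =>
                ((!![mj ^ 2 - mk ^ 2 - ml ^ 2, 2 * mk ^ 2 * ml ^ 2;
                     2, mj ^ 2 - mk ^ 2 - ml ^ 2] : Matrix (Fin 2) (Fin 2) ℝ)⁻¹.mulVec
                   ![1, 0] 0) • (v q * vt q)
                + ((!![mj ^ 2 - mk ^ 2 - ml ^ 2, 2 * mk ^ 2 * ml ^ 2;
                       2, mj ^ 2 - mk ^ 2 - ml ^ 2] : Matrix (Fin 2) (Fin 2) ℝ)⁻¹.mulVec
                     ![1, 0] 1) • Q0 v vt q) p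
              + mj ^ 2 • (fun q =>
                ((!![mj ^ 2 - mk ^ 2 - ml ^ 2, 2 * mk ^ 2 * ml ^ 2;
                     2, mj ^ 2 - mk ^ 2 - ml ^ 2] : Matrix (Fin 2) (Fin 2) ℝ)⁻¹.mulVec
                   ![1, 0] 0) • (v q * vt q)
                + ((!![mj ^ 2 - mk ^ 2 - ml ^ 2, 2 * mk ^ 2 * ml ^ 2;
                       2, mj ^ 2 - mk ^ 2 - ml ^ 2] : Matrix (Fin 2) (Fin 2) ℝ)⁻¹.mulVec
                     ![1, 0] 1) • Q0 v vt q) p)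
            + (∑ a : Fin 3, ∑ b : Fin 3, ∑ μ : Option (Fin 3), ∑ ν : Option (Fin 3),
                C1 a b μ ν • Qab a b (pdOpt μ v) (pdOpt ν vt) p)
            + (∑ μ : Option (Fin 3), ∑ ν : Option (Fin 3),
                C2 μ ν • (pdOpt μ v p * pdOpt ν (fun q => Box vt q + ml ^ 2 • vt q) p))
            + (∑ μ : Option (Fin 3), ∑ ν : Option (Fin 3),
                C3 μ ν • (pdOpt μ (fun q => Box v q + mk ^ 2 • v q) p * pdOpt ν vt p))
            + C4 • ((Box v p + mk ^ 2 • v p) * (Box vt p + ml ^ 2 • vt p)) := by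
  set A : Matrix (Fin 2) (Fin 2) ℝ := !![mj ^ 2 - mk ^ 2 - ml ^ 2, 2 * mk ^ 2 * ml ^ 2;
    2, mj ^ 2 - mk ^ 2 - ml ^ 2] with hA
  have hdet : IsUnit A.det := (resonance_det_ne_zero hres).isUnit
  have hsol : A *ᵥ (A⁻¹ *ᵥ ![1, 0]) = ![1, 0] := by
    rw [Matrix.mulVec_mulVec, Matrix.mul_nonsing_inv A hdet, Matrix.one_mulVec]
  generalize A⁻¹ *ᵥ ![1, 0] = x at hsol ⊢
  have e1 : (mj ^ 2 - mk ^ 2 - ml ^ 2) * x 0 + 2 * mk ^ 2 * ml ^ 2 * x 1 = 1 := by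
    simpa [hA, Matrix.mulVec, dotProduct, Fin.sum_univ_two] using congrFun hsol 0
  have e2 : 2 * x 0 + (mj ^ 2 - mk ^ 2 - ml ^ 2) * x 1 = 0 := by
    simpa [hA, Matrix.mulVec, dotProduct, Fin.sum_univ_two] using congrFun hsol 1
  clear hsol hdet hA
  generalize x 0 = c at e1 e2 ⊢
  generalize x 1 = d at e1 e2 ⊢
  refine ⟨fun a b μ ν => if μ = some a ∧ ν = some b then 2 * d * (eta a a * eta b b) else 0,
    fun μ ν => match μ, ν with
      | none, none => 2 * mk ^ 2 * d - c
      | some a, some b => d * eta a b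
      | _, _ => 0,
    fun μ ν => match μ, ν with
      | none, none => 2 * ml ^ 2 * d - c
      | some a, some b => d * eta a b
      | _, _ => 0,
    -2 * d, fun v vt hv hvt p => ?_⟩
  have hv3 : ContDiff ℝ 3 v := hv.of_le (by norm_num)
  have hvt3 : ContDiff ℝ 3 vt := hvt.of_le (by norm_num)
  have hv2 : ContDiff ℝ 2 v := hv.of_le (by norm_num)
  have hvt2 : ContDiff ℝ 2 vt := hvt.of_le (by norm_num)
  have hprod : ContDiff ℝ 2 (fun q => v q * vt q) := hv2.mul hvt2
  have hQ : ContDiff ℝ 2 (Q0 v vt) := contDiff_Q0 hv3 hvt3 (by norm_num)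
  have hC1 : (∑ a : Fin 3, ∑ b : Fin 3, ∑ μ : Option (Fin 3), ∑ ν : Option (Fin 3),
      (if μ = some a ∧ ν = some b then 2 * d * (eta a a * eta b b) else 0) •
        Qab a b (pdOpt μ v) (pdOpt ν vt) p) =
      (2 * d) • ∑ a : Fin 3, ∑ b : Fin 3,
        (eta a a * eta b b) • Qab a b (pd a v) (pd b vt) p := by
    simp only [ite_and, ite_smul, zero_smul, Finset.sum_ite_irrel, Finset.sum_const_zero,
      Finset.sum_ite_eq', Finset.mem_univ, if_true, pdOpt, Finset.smul_sum,
      mul_smul]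
  rw [hC1, Box_add (hprod.const_smul c) (hQ.const_smul d), Box_const_smul hprod,
    Box_const_smul hQ, Box_mul hv2 hvt2, Box_Q0 hv3 hvt3]
  generalize (∑ a : Fin 3, ∑ b : Fin 3,
    (eta a a * eta b b) • Qab a b (pd a v) (pd b vt) p) = S
  have e1' := congrArg (fun r : ℝ => (r : ℂ)) e1
  have e2' := congrArg (fun r : ℝ => (r : ℂ)) e2
  push_cast at e1' e2'
  simp only [Fintype.sum_option, Fin.sum_univ_three, pdOpt, pd_kleinGordon hv3,
    pd_kleinGordon hvt3, id, eta]
  simp [Q0, Complex.real_smul]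
  linear_combination (-(v p * vt p)) * e1' -
    (pd 0 v p * pd 0 vt p - pd 1 v p * pd 1 vt p - pd 2 v p * pd 2 vt p) * e2'

end
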